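/- arXiv:1207.5363 — 3 statements merged into one kernel-verified Lean document; each statement's English description precedes it below -/
import Mathlib

section
/- Let H be a weak Hopf algebra over a commutative ring k and (A, ρ_A) a right H-comodule algebra such that A_H ↪ A is an H-cleft extension with cleaving morphism f (with convolution inverse f^{-1}). Then ρ_A∘f^{-1} = (f^{-1}⊗λ_H)∘c_{H,H}∘δ_H. -/
open TensorProduct

noncomputable section

namespace WHA

variable (k : Type) [CommRing k]

/-- Generalized convolution product of two linear maps from a "coalgebra"
(given by a comultiplication `δC`) to a module `P` with a product `m`. -/
def convG {C P : Type} [AddCommGroup C] [Module k C] [AddCommGroup P] [Module k P]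
    (δC : C →ₗ[k] C ⊗[k] C) (m : P ⊗[k] P →ₗ[k] P) (f g : C →ₗ[k] P) : C →ₗ[k] P :=
  m ∘ₗ TensorProduct.map f g ∘ₗ δC

/-- Convolution product of two linear maps from a "coalgebra" to an algebra. -/
def conv {C A : Type} [AddCommGroup C] [Module k C] [Ring A] [Algebra k A]
    (δC : C →ₗ[k] C ⊗[k] C) (f g : C →ₗ[k] A) : C →ₗ[k] A :=
  convG k δC (LinearMap.mul' k A) f g

variable (H : Type) [Ring H] [Algebra k H]

/-- The structure maps (comultiplication, counit, antipode) of a prospective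
weak Hopf algebra on the `k`-algebra `H`. -/
structure HopfData where
  δ : H →ₗ[k] H ⊗[k] H
  ε : H →ₗ[k] k
  lam : H →ₗ[k] H

variable {k H}

/-- The target map `Π^L_H = ((ε∘μ)⊗H)∘(H⊗c)∘((δ∘η)⊗H)`. -/
def PiL (W : HopfData k H) : H →ₗ[k] H :=
  (TensorProduct.rid k H).toLinearMap
    ∘ₗ LinearMap.lTensor H (W.ε ∘ₗ LinearMap.mul' k H)
    ∘ₗ (TensorProduct.assoc k H H H).toLinearMap
    ∘ₗ LinearMap.rTensor H (TensorProduct.comm k H H).toLinearMap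
    ∘ₗ TensorProduct.mk k (H ⊗[k] H) H (W.δ 1)

/-- The source map `Π^R_H = (H⊗(ε∘μ))∘(c⊗H)∘(H⊗(δ∘η))`. -/
def PiR (W : HopfData k H) : H →ₗ[k] H :=
  (TensorProduct.lid k H).toLinearMap
    ∘ₗ LinearMap.rTensor H (W.ε ∘ₗ LinearMap.mul' k H)
    ∘ₗ (TensorProduct.assoc k H H H).symm.toLinearMap
    ∘ₗ LinearMap.lTensor H (TensorProduct.comm k H H).toLinearMap
    ∘ₗ (TensorProduct.mk k H (H ⊗[k] H)).flip (W.δ 1)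

/-- `H` together with the data `W` is a weak Hopf algebra. -/
structure IsWeakHopf (W : HopfData k H) : Prop where
  coassoc : ∀ h : H,
    (TensorProduct.assoc k H H H) ((LinearMap.rTensor H W.δ) (W.δ h)) =
      (LinearMap.lTensor H W.δ) (W.δ h)
  counit_left : ∀ h : H, (TensorProduct.lid k H) ((LinearMap.rTensor H W.ε) (W.δ h)) = h
  counit_right : ∀ h : H, (TensorProduct.rid k H) ((LinearMap.lTensor H W.ε) (W.δ h)) = h
  a1 : ∀ x y : H, W.δ (x * y) = W.δ x * W.δ y
  a2 : ∀ x y z : H, W.ε (x * y * z) =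
    LinearMap.mul' k k ((TensorProduct.map (W.ε ∘ₗ LinearMap.mulLeft k x)
      (W.ε ∘ₗ LinearMap.mulRight k z)) (W.δ y))
  a2' : ∀ x y z : H, W.ε (x * y * z) =
    LinearMap.mul' k k ((TensorProduct.map (W.ε ∘ₗ LinearMap.mulLeft k x)
      (W.ε ∘ₗ LinearMap.mulRight k z)) ((TensorProduct.comm k H H) (W.δ y)))
  a3 : (TensorProduct.assoc k H H H) ((LinearMap.rTensor H W.δ) (W.δ 1)) =
    (TensorProduct.map LinearMap.id
        (Algebra.TensorProduct.includeLeft : H →ₐ[k] H ⊗[k] H).toLinearMap) (W.δ 1) *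
      (Algebra.TensorProduct.includeRight : (H ⊗[k] H) →ₐ[k] H ⊗[k] (H ⊗[k] H)).toLinearMap
        (W.δ 1)
  a3' : (TensorProduct.assoc k H H H) ((LinearMap.rTensor H W.δ) (W.δ 1)) =
    (Algebra.TensorProduct.includeRight : (H ⊗[k] H) →ₐ[k] H ⊗[k] (H ⊗[k] H)).toLinearMap
        (W.δ 1) *
      (TensorProduct.map LinearMap.id
        (Algebra.TensorProduct.includeLeft : H →ₐ[k] H ⊗[k] H).toLinearMap) (W.δ 1)
  a4_left : ∀ h : H,
    LinearMap.mul' k H ((TensorProduct.map LinearMap.id W.lam) (W.δ h)) = PiL W h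
  a4_right : ∀ h : H,
    LinearMap.mul' k H ((TensorProduct.map W.lam LinearMap.id) (W.δ h)) = PiR W h
  a4_mid : conv k W.δ (conv k W.δ W.lam LinearMap.id) W.lam = W.lam

/-- `H` is cocommutative. -/
def Cocomm (W : HopfData k H) : Prop :=
  ∀ h : H, (TensorProduct.comm k H H) (W.δ h) = W.δ h

section ComodAlg

variable {A : Type} [Ring A] [Algebra k A]

/-- The map `ζ_A = (μ_A⊗H)∘(A⊗c_{H,A})∘((ρ_A∘η_A)⊗A)`; in the tensor product
algebra `A ⊗ H` it is given by `a ↦ ρ(1) * (a ⊗ 1)`. -/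
def zeta (ρ : A →ₗ[k] A ⊗[k] H) (a : A) : A ⊗[k] H :=
  ρ 1 * (a ⊗ₜ[k] (1 : H))

/-- `a` is a coinvariant element, i.e. belongs to `A_H`. -/
def IsCoinv (ρ : A →ₗ[k] A ⊗[k] H) (a : A) : Prop :=
  ρ a = zeta ρ a

/-- `(A, ρ)` is a right `H`-comodule algebra. -/
structure IsComodAlg (W : HopfData k H) (ρ : A →ₗ[k] A ⊗[k] H) : Prop where
  coassoc : ∀ a : A, (TensorProduct.assoc k A H H) ((LinearMap.rTensor H ρ) (ρ a)) =
    (LinearMap.lTensor A W.δ) (ρ a)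
  counit : ∀ a : A, (TensorProduct.rid k A) ((LinearMap.lTensor A W.ε) (ρ a)) = a
  mul_compat : ∀ a b : A, ρ (a * b) = ρ a * ρ b
  unit_coinv : (LinearMap.lTensor A (PiL W)) (ρ 1) = ρ 1

end ComodAlg

/-- For `t = Σ x ⊗ y : B ⊗ H`, the map `h ↦ Σ ε(h*y) • x`.  For
`t = ρ(1)` this is the map `e_A = (A⊗ε)∘Γ∘(H⊗η)`. -/
def eGen (W : HopfData k H) {B : Type} [AddCommGroup B] [Module k B]
    (t : B ⊗[k] H) : H →ₗ[k] B :=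
  (TensorProduct.lid k B).toLinearMap
    ∘ₗ LinearMap.rTensor B (W.ε ∘ₗ LinearMap.mul' k H)
    ∘ₗ (TensorProduct.assoc k H H B).symm.toLinearMap
    ∘ₗ LinearMap.lTensor H (TensorProduct.comm k B H).toLinearMap
    ∘ₗ (TensorProduct.mk k H (B ⊗[k] H)).flip t

/-- For `t = Σ x ⊗ y : B ⊗ H`, the map `h ↦ Σ ε(y*h) • x`.  For
`t = ρ(1)` this is the map `(A⊗(ε∘μ))∘((ρ∘η)⊗H)`. -/
def dGen (W : HopfData k H) {B : Type} [AddCommGroup B] [Module k B]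
    (t : B ⊗[k] H) : H →ₗ[k] B :=
  (TensorProduct.rid k B).toLinearMap
    ∘ₗ LinearMap.lTensor B (W.ε ∘ₗ LinearMap.mul' k H)
    ∘ₗ (TensorProduct.assoc k B H H).toLinearMap
    ∘ₗ TensorProduct.mk k (B ⊗[k] H) H t

section ComodAlg2

variable {A : Type} [Ring A] [Algebra k A]

/-- The entwining map `Γ_A^H = (A⊗μ_H)∘(c_{H,A}⊗H)∘(H⊗ρ_A)`. -/
def Γmap (ρ : A →ₗ[k] A ⊗[k] H) : H ⊗[k] A →ₗ[k] A ⊗[k] H :=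
  LinearMap.lTensor A (LinearMap.mul' k H)
    ∘ₗ (TensorProduct.assoc k A H H).toLinearMap
    ∘ₗ LinearMap.rTensor H (TensorProduct.comm k H A).toLinearMap
    ∘ₗ (TensorProduct.assoc k H A H).symm.toLinearMap
    ∘ₗ LinearMap.lTensor H ρ

/-- `f : H → A` is an integral, i.e. a morphism of right `H`-comodules. -/
def IsIntegral (W : HopfData k H) (ρ : A →ₗ[k] A ⊗[k] H) (f : H →ₗ[k] A) : Prop :=
  ∀ h : H, ρ (f h) = (LinearMap.rTensor H f) (W.δ h)

/-- `finv` is the convolution inverse of the integral `f` (conditions (c1)-(c3)). -/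
def IsConvInv (W : HopfData k H) (ρ : A →ₗ[k] A ⊗[k] H) (f finv : H →ₗ[k] A) : Prop :=
  conv k W.δ finv f = eGen W (ρ 1) ∧
  conv k W.δ f finv = dGen W (ρ 1) ∧
  conv k W.δ (conv k W.δ finv f) finv = finv

/-- `f` is a cleaving morphism (with convolution inverse `finv`) for the extension
`A_H ↪ A`, i.e. a convolution invertible integral such that `f ∧ f⁻¹` takes
values in the coinvariants. -/
def IsCleaving (W : HopfData k H) (ρ : A →ₗ[k] A ⊗[k] H) (f finv : H →ₗ[k] A) : Prop :=
  IsIntegral W ρ f ∧ IsConvInv W ρ f finv ∧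
    ∀ h : H, IsCoinv ρ (conv k W.δ f finv h)

end ComodAlg2

section ModAlg

variable {B : Type} [Ring B] [Algebra k B]

/-- `u₁ = φ ∘ (H ⊗ η_B)`. -/
def u1 (φ : H ⊗[k] B →ₗ[k] B) : H →ₗ[k] B :=
  φ ∘ₗ (TensorProduct.mk k H B).flip 1

/-- `u₂ = u₁ ∘ μ_H`. -/
def u2 (φ : H ⊗[k] B →ₗ[k] B) : H ⊗[k] H →ₗ[k] B :=
  u1 φ ∘ₗ LinearMap.mul' k H

/-- `(B, φ)` is a weak left `H`-module algebra (conditions (d1)-(d4)). -/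
def IsWeakModAlg (W : HopfData k H) (φ : H ⊗[k] B →ₗ[k] B) : Prop :=
  (∀ b : B, φ ((1 : H) ⊗ₜ[k] b) = b) ∧
  (∀ (h : H) (b c : B), φ (h ⊗ₜ[k] (b * c)) =
    LinearMap.mul' k B ((TensorProduct.map (φ ∘ₗ (TensorProduct.mk k H B).flip b)
      (φ ∘ₗ (TensorProduct.mk k H B).flip c)) (W.δ h))) ∧
  (∀ g h : H, φ ((g * h) ⊗ₜ[k] (1 : B)) = φ (g ⊗ₜ[k] φ (h ⊗ₜ[k] (1 : B)))) ∧
  (∀ (h : H) (b : B), φ (PiL W h ⊗ₜ[k] b) = φ (h ⊗ₜ[k] (1 : B)) * b)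

/-- `(B, φ)` is a left `H`-module algebra. -/
def IsModAlg (W : HopfData k H) (φ : H ⊗[k] B →ₗ[k] B) : Prop :=
  IsWeakModAlg W φ ∧
    ∀ (g h : H) (b : B), φ ((g * h) ⊗ₜ[k] b) = φ (g ⊗ₜ[k] φ (h ⊗ₜ[k] b))

/-- `(h, hinv)` is a pair of mutually convolution inverse elements in
`Reg_{φ}(H,B)`. -/
def IsRegPair (W : HopfData k H) (φ : H ⊗[k] B →ₗ[k] B) (h hinv : H →ₗ[k] B) : Prop :=
  conv k W.δ h hinv = u1 φ ∧ conv k W.δ hinv h = u1 φ ∧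
  conv k W.δ (conv k W.δ h hinv) h = h ∧
  conv k W.δ (conv k W.δ hinv h) hinv = hinv

end ModAlg

/-- The comultiplication of the tensor product coalgebra `H ⊗ H`. -/
def δ2 (W : HopfData k H) : H ⊗[k] H →ₗ[k] (H ⊗[k] H) ⊗[k] (H ⊗[k] H) :=
  (TensorProduct.tensorTensorTensorComm k H H H H).toLinearMap
    ∘ₗ TensorProduct.map W.δ W.δ

/-- The comultiplication of the tensor product coalgebra `H ⊗ (H ⊗ H)`. -/
def δ3 (W : HopfData k H) :
    H ⊗[k] (H ⊗[k] H) →ₗ[k] (H ⊗[k] (H ⊗[k] H)) ⊗[k] (H ⊗[k] (H ⊗[k] H)) :=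
  (TensorProduct.tensorTensorTensorComm k H H (H ⊗[k] H) (H ⊗[k] H)).toLinearMap
    ∘ₗ TensorProduct.map W.δ (δ2 W)

section ModAlg2

variable {B : Type} [Ring B] [Algebra k B]

/-- `(σ, σinv)` is a pair of mutually convolution inverse elements in
`Reg_{φ}(H⊗H,B)`. -/
def IsRegPair2 (W : HopfData k H) (φ : H ⊗[k] B →ₗ[k] B)
    (σ σinv : H ⊗[k] H →ₗ[k] B) : Prop :=
  conv k (δ2 W) σ σinv = u2 φ ∧ conv k (δ2 W) σinv σ = u2 φ ∧
  conv k (δ2 W) (conv k (δ2 W) σ σinv) σ = σ ∧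
  conv k (δ2 W) (conv k (δ2 W) σinv σ) σinv = σinv

/-- Condition (g1) (the twisted condition). -/
def CrossedG1 (W : HopfData k H) (φ : H ⊗[k] B →ₗ[k] B) (σ : H ⊗[k] H →ₗ[k] B) : Prop :=
  ∀ (x y : H) (b : B),
    LinearMap.mul' k B ((TensorProduct.map σ
        ((φ ∘ₗ (TensorProduct.mk k H B).flip b) ∘ₗ LinearMap.mul' k H))
      (δ2 W (x ⊗ₜ[k] y))) =
    LinearMap.mul' k B ((TensorProduct.map
        (φ ∘ₗ LinearMap.lTensor H (φ ∘ₗ (TensorProduct.mk k H B).flip b)) σ)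
      (δ2 W (x ⊗ₜ[k] y)))

/-- Condition (g2) (the cocycle condition). -/
def CrossedG2 (W : HopfData k H) (φ : H ⊗[k] B →ₗ[k] B) (σ : H ⊗[k] H →ₗ[k] B) : Prop :=
  conv k (δ3 W) (φ ∘ₗ LinearMap.lTensor H σ)
      (σ ∘ₗ LinearMap.lTensor H (LinearMap.mul' k H)) =
  conv k (δ3 W)
      ((TensorProduct.rid k B).toLinearMap ∘ₗ TensorProduct.map σ W.ε
        ∘ₗ (TensorProduct.assoc k H H H).symm.toLinearMap)
      (σ ∘ₗ LinearMap.rTensor H (LinearMap.mul' k H)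
        ∘ₗ (TensorProduct.assoc k H H H).symm.toLinearMap)

/-- Condition (g3) (the normal condition). -/
def CrossedG3 (W : HopfData k H) (φ : H ⊗[k] B →ₗ[k] B) (σ : H ⊗[k] H →ₗ[k] B) : Prop :=
  ∀ h : H, σ (h ⊗ₜ[k] (1 : H)) = u1 φ h ∧ σ ((1 : H) ⊗ₜ[k] h) = u1 φ h

/-- `(φ, σ)` is a crossed system for `H` over `B`, with `σinv` the convolution
inverse of `σ`. -/
def IsCrossedSystem (W : HopfData k H) (φ : H ⊗[k] B →ₗ[k] B)
    (σ σinv : H ⊗[k] H →ₗ[k] B) : Prop :=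
  IsWeakModAlg W φ ∧ IsRegPair2 W φ σ σinv ∧
    CrossedG1 W φ σ ∧ CrossedG2 W φ σ ∧ CrossedG3 W φ σ

/-- The condition that `h` conjugates the weak action `ϕ` into `φ`. -/
def FisEq (W : HopfData k H) (φ ϕ : H ⊗[k] B →ₗ[k] B) (h hinv : H →ₗ[k] B) : Prop :=
  ∀ (g : H) (b : B), φ (g ⊗ₜ[k] b) =
    (LinearMap.mul' k B ∘ₗ LinearMap.rTensor B (LinearMap.mul' k B))
      ((TensorProduct.map (TensorProduct.map h (ϕ ∘ₗ (TensorProduct.mk k H B).flip b)) hinv)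
        ((LinearMap.rTensor H W.δ) (W.δ g)))

/-- The condition that `h` transforms the cocycle `τ` into `σ`. -/
def SigmasEq (W : HopfData k H) (ϕ : H ⊗[k] B →ₗ[k] B)
    (σ τ : H ⊗[k] H →ₗ[k] B) (h hinv : H →ₗ[k] B) : Prop :=
  σ = conv k (δ2 W)
    (LinearMap.mul' k B ∘ₗ TensorProduct.map h ϕ
      ∘ₗ (TensorProduct.assoc k H H B).toLinearMap ∘ₗ TensorProduct.map W.δ h)
    (conv k (δ2 W) τ (hinv ∘ₗ LinearMap.mul' k H))

/-- `h` (with convolution inverse `hinv`) realizes an equivalence between the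
crossed systems `(φ, σ)` and `(ϕ, τ)`. -/
def RealizesEquiv (W : HopfData k H) (φ ϕ : H ⊗[k] B →ₗ[k] B)
    (σ τ : H ⊗[k] H →ₗ[k] B) (h hinv : H →ₗ[k] B) : Prop :=
  IsRegPair W φ h hinv ∧ IsRegPair W ϕ h hinv ∧ h 1 = 1 ∧
    FisEq W φ ϕ h hinv ∧ SigmasEq W ϕ σ τ h hinv

/-- The crossed systems `(φ, σ)` and `(ϕ, τ)` are equivalent. -/
def CrossedEquiv (W : HopfData k H) (φ ϕ : H ⊗[k] B →ₗ[k] B)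
    (σ τ : H ⊗[k] H →ₗ[k] B) : Prop :=
  u1 φ = u1 ϕ ∧ ∃ h hinv : H →ₗ[k] B, RealizesEquiv W φ ϕ σ τ h hinv

/-- The map `ψ_H^B = (φ⊗H)∘(H⊗c_{H,B})∘(δ_H⊗B)`. -/
def ψmap (W : HopfData k H) (φ : H ⊗[k] B →ₗ[k] B) : H ⊗[k] B →ₗ[k] B ⊗[k] H :=
  LinearMap.rTensor H φ
    ∘ₗ (TensorProduct.assoc k H B H).symm.toLinearMap
    ∘ₗ LinearMap.lTensor H (TensorProduct.comm k H B).toLinearMap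
    ∘ₗ (TensorProduct.assoc k H H B).toLinearMap
    ∘ₗ LinearMap.rTensor B W.δ

/-- The map `σ_H^B = (σ⊗μ_H)∘δ_{H⊗H}`. -/
def σHA (W : HopfData k H) (σ : H ⊗[k] H →ₗ[k] B) : H ⊗[k] H →ₗ[k] B ⊗[k] H :=
  TensorProduct.map σ (LinearMap.mul' k H) ∘ₗ δ2 W

/-- The idempotent `∇_{B⊗H} = (μ_B⊗H)∘(B⊗ψ_H^B)∘(B⊗H⊗η_B)`. -/
def nabla (W : HopfData k H) (φ : H ⊗[k] B →ₗ[k] B) : B ⊗[k] H →ₗ[k] B ⊗[k] H :=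
  LinearMap.rTensor H (LinearMap.mul' k B)
    ∘ₗ (TensorProduct.assoc k B B H).symm.toLinearMap
    ∘ₗ LinearMap.lTensor B (ψmap W φ)
    ∘ₗ LinearMap.lTensor B ((TensorProduct.mk k H B).flip 1)

/-- The product `(μ_B⊗H)∘(μ_B⊗σ_H^B)∘(B⊗ψ_H^B⊗H)` on `B ⊗ H`. -/
def crossmulAmb (W : HopfData k H) (φ : H ⊗[k] B →ₗ[k] B) (σ : H ⊗[k] H →ₗ[k] B) :
    (B ⊗[k] H) ⊗[k] (B ⊗[k] H) →ₗ[k] B ⊗[k] H :=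
  LinearMap.rTensor H (LinearMap.mul' k B)
    ∘ₗ (TensorProduct.assoc k B B H).symm.toLinearMap
    ∘ₗ LinearMap.lTensor B (LinearMap.rTensor H (LinearMap.mul' k B))
    ∘ₗ LinearMap.lTensor B ((TensorProduct.assoc k B B H).symm.toLinearMap)
    ∘ₗ LinearMap.lTensor B (LinearMap.lTensor B (σHA W σ))
    ∘ₗ LinearMap.lTensor B ((TensorProduct.assoc k B H H).toLinearMap)
    ∘ₗ LinearMap.lTensor B (LinearMap.rTensor H (ψmap W φ))
    ∘ₗ LinearMap.lTensor B ((TensorProduct.assoc k H B H).symm.toLinearMap)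
    ∘ₗ (TensorProduct.assoc k B H (B ⊗[k] H)).toLinearMap

end ModAlg2

section CrossProd

variable {B : Type} [Ring B] [Algebra k B]
variable {P : Type} [AddCommGroup P] [Module k P]

/-- The product of the weak crossed product `B ×_σ H`, through a splitting
`(P, p, ι)` of the idempotent `∇_{B⊗H}`. -/
def crossMul (W : HopfData k H) (φ : H ⊗[k] B →ₗ[k] B) (σ : H ⊗[k] H →ₗ[k] B)
    (p : B ⊗[k] H →ₗ[k] P) (ι : P →ₗ[k] B ⊗[k] H) : P ⊗[k] P →ₗ[k] P :=
  p ∘ₗ crossmulAmb W φ σ ∘ₗ TensorProduct.map ι ι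

/-- The unit of the weak crossed product `B ×_σ H`. -/
def crossUnit (W : HopfData k H) (φ : H ⊗[k] B →ₗ[k] B)
    (p : B ⊗[k] H →ₗ[k] P) : P :=
  p (nabla W φ ((1 : B) ⊗ₜ[k] (1 : H)))

/-- The coaction `ρ_{B×H} = (p⊗H)∘(B⊗δ_H)∘ι` of the weak crossed product. -/
def crossCoact (W : HopfData k H)
    (p : B ⊗[k] H →ₗ[k] P) (ι : P →ₗ[k] B ⊗[k] H) : P →ₗ[k] P ⊗[k] H :=
  LinearMap.rTensor H p ∘ₗ (TensorProduct.assoc k B H H).symm.toLinearMap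
    ∘ₗ LinearMap.lTensor B W.δ ∘ₗ ι

/-- The inclusion `i_{B×H} = p∘(B⊗η_H) : B → B × H`. -/
def crossInc (p : B ⊗[k] H →ₗ[k] P) : B →ₗ[k] P :=
  p ∘ₗ (TensorProduct.mk k B H).flip 1

/-- The analogue of `ζ` for an abstract module `P` with product `m`:
`ζ(x) = t · (x ⊗ 1)` where `t` plays the role of `ρ(1)`. -/
def zetaGen (m : P ⊗[k] P →ₗ[k] P) (t : P ⊗[k] H) (x : P) : P ⊗[k] H :=
  (TensorProduct.map m (LinearMap.mul' k H))
    ((TensorProduct.tensorTensorTensorComm k P H P H) (t ⊗ₜ[k] (x ⊗ₜ[k] (1 : H))))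

end CrossProd

section Induced

variable {D P : Type} [AddCommGroup D] [Module k D] [AddCommGroup P] [Module k P]

/-- The map `(P⊗P)⊗P → P`, `(x⊗y)⊗z ↦ x·(z·y)`. -/
def mulSwizG (m : P ⊗[k] P →ₗ[k] P) : (P ⊗[k] P) ⊗[k] P →ₗ[k] P :=
  m ∘ₗ LinearMap.lTensor P (m ∘ₗ (TensorProduct.comm k P P).toLinearMap)
    ∘ₗ (TensorProduct.assoc k P P P).toLinearMap

/-- The ambient weak action `μ∘(P⊗(μ∘c))∘(((f⊗f⁻¹)∘δ_H)⊗j) : H ⊗ D → P`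
induced by a cleaving morphism `f`. -/
def phiAmb (W : HopfData k H) (m : P ⊗[k] P →ₗ[k] P) (f finv : H →ₗ[k] P)
    (j : D →ₗ[k] P) : H ⊗[k] D →ₗ[k] P :=
  mulSwizG m ∘ₗ TensorProduct.map ((TensorProduct.map f finv) ∘ₗ W.δ) j

/-- The ambient cocycle `(μ∘(f⊗f)) ∧ (f⁻¹∘μ_H) : H ⊗ H → P` induced by a
cleaving morphism `f`. -/
def sigmaAmb (W : HopfData k H) (m : P ⊗[k] P →ₗ[k] P) (f finv : H →ₗ[k] P) :
    H ⊗[k] H →ₗ[k] P :=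
  convG k (δ2 W) m (m ∘ₗ TensorProduct.map f f) (finv ∘ₗ LinearMap.mul' k H)

end Induced

section Pres

variable {A D : Type} [Ring A] [Algebra k A] [Ring D] [Algebra k D]

/-- `j : D → A` presents `D` as the subalgebra of coinvariants of `A`. -/
def IsCoinvPres (ρ : A →ₗ[k] A ⊗[k] H) (j : D →ₐ[k] A) : Prop :=
  Function.Injective j ∧ ∀ a : A, IsCoinv ρ a ↔ a ∈ Set.range j

end Pres

section CleavingCoaction

variable {A : Type} [Ring A] [Algebra k A]

section Conv

variable {δ : H →ₗ[k] H ⊗[k] H}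
variable {B C : Type} [Ring B] [Algebra k B] [Ring C] [Algebra k C]

theorem conv_apply (a b : H →ₗ[k] B) (h : H) :
    conv k δ a b h = LinearMap.mul' k B (TensorProduct.map a b (δ h)) := rfl

theorem conv_assoc
    (hδ : ∀ h : H, (TensorProduct.assoc k H H H) ((LinearMap.rTensor H δ) (δ h)) =
      (LinearMap.lTensor H δ) (δ h))
    (a b c : H →ₗ[k] B) :
    conv k δ (conv k δ a b) c = conv k δ a (conv k δ b c) := by
  let triple : H ⊗[k] (H ⊗[k] H) →ₗ[k] B :=
    LinearMap.mul' k B ∘ₗ TensorProduct.map a (LinearMap.mul' k B ∘ₗ TensorProduct.map b c)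
  have hl : ∀ s : H ⊗[k] H, LinearMap.mul' k B (TensorProduct.map (conv k δ a b) c s) =
      triple ((TensorProduct.assoc k H H H) ((LinearMap.rTensor H δ) s)) := by
    intro s
    induction s with
    | zero => simp
    | add x y hx hy => simp only [map_add, hx, hy]
    | tmul x y =>
      simp only [TensorProduct.map_tmul, LinearMap.mul'_apply, conv_apply,
        LinearMap.rTensor_tmul]
      generalize δ x = t
      induction t with
      | zero => simp
      | add x y hx hy => simp only [map_add, add_mul, TensorProduct.add_tmul, hx, hy]
      | tmul p q => simp [triple, mul_assoc]
  have hr : ∀ s : H ⊗[k] H, LinearMap.mul' k B (TensorProduct.map a (conv k δ b c) s) =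
      triple ((LinearMap.lTensor H δ) s) := by
    intro s
    induction s with
    | zero => simp
    | add x y hx hy => simp only [map_add, hx, hy]
    | tmul x y => simp [triple, conv_apply]
  ext h
  rw [conv_apply, conv_apply, hl, hr, hδ]

theorem comp_conv (φ : B →ₗ[k] C) (hφ : ∀ x y, φ (x * y) = φ x * φ y) (a b : H →ₗ[k] B) :
    φ ∘ₗ conv k δ a b = conv k δ (φ ∘ₗ a) (φ ∘ₗ b) := by
  ext h
  simp only [LinearMap.comp_apply, conv_apply]
  generalize δ h = t
  induction t with
  | zero => simp
  | add x y hx hy => simp only [map_add, hx, hy]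
  | tmul p q => simp [hφ]

theorem conv_mulLeft_comp (c : B) (a b : H →ₗ[k] B) :
    conv k δ (LinearMap.mulLeft k c ∘ₗ a) b = LinearMap.mulLeft k c ∘ₗ conv k δ a b := by
  ext h
  simp only [LinearMap.comp_apply, conv_apply]
  generalize δ h = t
  induction t with
  | zero => simp
  | add x y hx hy => simp only [map_add, hx, hy]
  | tmul p q => simp [mul_assoc]

theorem conv_mulRight_comp (c : B) (a b : H →ₗ[k] B) :
    conv k δ a (LinearMap.mulRight k c ∘ₗ b) = LinearMap.mulRight k c ∘ₗ conv k δ a b := by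
  ext h
  simp only [LinearMap.comp_apply, conv_apply]
  generalize δ h = t
  induction t with
  | zero => simp
  | add x y hx hy => simp only [map_add, hx, hy]
  | tmul p q => simp [mul_assoc]

variable (k H A) in
/-- The inclusion `a ↦ a ⊗ 1` of `A` into `A ⊗ H`. -/
def inA : A →ₗ[k] A ⊗[k] H := (TensorProduct.mk k A H).flip 1

variable (k H A) in
/-- The inclusion `h ↦ 1 ⊗ h` of `H` into `A ⊗ H`. -/
def inH : H →ₗ[k] A ⊗[k] H := TensorProduct.mk k A H 1

@[simp]
theorem inA_apply (a : A) : inA k H A a = a ⊗ₜ[k] (1 : H) := rfl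

@[simp]
theorem inH_apply (h : H) : inH k H A h = (1 : A) ⊗ₜ[k] h := rfl

theorem inA_comp_conv (a b : H →ₗ[k] A) :
    inA k H A ∘ₗ conv k δ a b = conv k δ (inA k H A ∘ₗ a) (inA k H A ∘ₗ b) :=
  comp_conv _ (by simp) a b

theorem inH_comp_conv (a b : H →ₗ[k] H) :
    inH k H A ∘ₗ conv k δ a b = conv k δ (inH k H A ∘ₗ a) (inH k H A ∘ₗ b) :=
  comp_conv _ (by simp) a b

theorem conv_inA_inH (a : H →ₗ[k] A) (b : H →ₗ[k] H) :
    conv k δ (inA k H A ∘ₗ a) (inH k H A ∘ₗ b) = TensorProduct.map a b ∘ₗ δ := by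
  ext h
  simp only [LinearMap.comp_apply, conv_apply]
  generalize δ h = t
  induction t with
  | zero => simp
  | add x y hx hy => simp only [map_add, hx, hy]
  | tmul p q => simp

theorem conv_inH_inA (a : H →ₗ[k] A) (b : H →ₗ[k] H) :
    conv k δ (inH k H A ∘ₗ b) (inA k H A ∘ₗ a) =
      TensorProduct.map a b ∘ₗ (TensorProduct.comm k H H).toLinearMap ∘ₗ δ := by
  ext h
  simp only [LinearMap.comp_apply, conv_apply]
  generalize δ h = t
  induction t with
  | zero => simp
  | add x y hx hy => simp only [map_add, hx, hy]
  | tmul p q => simp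

theorem lTensor_mulLeft (z : H) (t : A ⊗[k] H) :
    LinearMap.lTensor A (LinearMap.mulLeft k z) t = ((1 : A) ⊗ₜ[k] z) * t := by
  induction t with
  | zero => simp
  | add x y hx hy => simp only [map_add, mul_add, hx, hy]
  | tmul x y => simp

end Conv

section Evaluation

variable {W : HopfData k H} {B : Type} [AddCommGroup B] [Module k B]

@[simp]
theorem eGen_tmul (x : B) (y h : H) : eGen W (x ⊗ₜ[k] y) h = W.ε (h * y) • x := by
  simp [eGen]

@[simp]
theorem dGen_tmul (x : B) (y h : H) : dGen W (x ⊗ₜ[k] y) h = W.ε (y * h) • x := by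
  simp [dGen]

@[simp]
theorem eGen_add (s t : B ⊗[k] H) : eGen W (s + t) = eGen W s + eGen W t := by
  ext h
  simp [eGen]

@[simp]
theorem dGen_add (s t : B ⊗[k] H) : dGen W (s + t) = dGen W s + dGen W t := by
  ext h
  simp [dGen]

@[simp]
theorem eGen_zero : eGen W (0 : B ⊗[k] H) = 0 := by
  ext h
  simp [eGen]

@[simp]
theorem dGen_zero : dGen W (0 : B ⊗[k] H) = 0 := by
  ext h
  simp [dGen]

theorem PiR_eq_eGen : PiR W = eGen W (W.δ 1) := rfl

theorem PiL_eq_dGen : PiL W = dGen W (TensorProduct.comm k H H (W.δ 1)) := rfl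

end Evaluation

variable {W : HopfData k H}

/-- On the image of `Π^L`, the comultiplication is `z ↦ δ(1) (z ⊗ 1)`. -/
theorem IsWeakHopf.delta_PiL (hW : IsWeakHopf W) (x : H) :
    W.δ (PiL W x) = W.δ 1 * (PiL W x ⊗ₜ[k] (1 : H)) := by
  let evalFst : H ⊗[k] (H ⊗[k] H) →ₗ[k] H ⊗[k] H :=
    (TensorProduct.lid k (H ⊗[k] H)).toLinearMap ∘ₗ
      LinearMap.rTensor (H ⊗[k] H) (W.ε ∘ₗ LinearMap.mulRight k x)
  have hl : ∀ s : H ⊗[k] H, W.δ (dGen W (TensorProduct.comm k H H s) x) =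
      evalFst (LinearMap.lTensor H W.δ s) := by
    intro s
    induction s with
    | zero => simp
    | add s t hs ht => simp only [map_add, dGen_add, LinearMap.add_apply, hs, ht]
    | tmul p q => simp [evalFst]
  have hr : ∀ r s : H ⊗[k] H, evalFst
      ((Algebra.TensorProduct.includeRight : (H ⊗[k] H) →ₐ[k] H ⊗[k] (H ⊗[k] H)).toLinearMap r *
        (TensorProduct.map LinearMap.id
          (Algebra.TensorProduct.includeLeft : H →ₐ[k] H ⊗[k] H).toLinearMap) s) =
      r * (dGen W (TensorProduct.comm k H H s) x ⊗ₜ[k] (1 : H)) := by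
    intro r s
    induction s with
    | zero => simp
    | add s t hs ht =>
      simp only [map_add, dGen_add, LinearMap.add_apply, mul_add, TensorProduct.add_tmul, hs, ht]
    | tmul p q => simp [evalFst, ← TensorProduct.smul_tmul']
  rw [PiL_eq_dGen, hl, ← hW.coassoc, hW.a3', hr]

/-- `Σ ε(h₁ z) h₂ = h z` for `z` in the image of `Π^L`. -/
theorem IsWeakHopf.counit_mul_PiL (hW : IsWeakHopf W) (h x : H) :
    TensorProduct.lid k H (LinearMap.rTensor H W.ε (W.δ h * (PiL W x ⊗ₜ[k] (1 : H)))) =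
      h * PiL W x := by
  conv_lhs => rw [← mul_one h, hW.a1, mul_assoc, ← hW.delta_PiL, ← hW.a1]
  exact hW.counit_left _

variable {ρ : A →ₗ[k] A ⊗[k] H}

theorem IsComodAlg.lTensor_coaction_one_congr (hρ : IsComodAlg W ρ)
    {P : Type} [AddCommGroup P] [Module k P] {a b : H →ₗ[k] P}
    (hab : ∀ x, a (PiL W x) = b (PiL W x)) :
    LinearMap.lTensor A a (ρ 1) = LinearMap.lTensor A b (ρ 1) := by
  have hcomp : a ∘ₗ PiL W = b ∘ₗ PiL W := LinearMap.ext hab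
  rw [← hρ.unit_coinv, ← LinearMap.lTensor_comp_apply, ← LinearMap.lTensor_comp_apply, hcomp]

theorem IsComodAlg.lTensor_delta_one (hW : IsWeakHopf W) (hρ : IsComodAlg W ρ) :
    LinearMap.lTensor A W.δ (ρ 1) =
      LinearMap.lTensor A (LinearMap.mulLeft k (W.δ 1) ∘ₗ inA k H H) (ρ 1) :=
  hρ.lTensor_coaction_one_congr fun x => by simpa using hW.delta_PiL x

/-- `Σ a₀ ⊗ Π^L(a₁) = ρ(1) (a ⊗ 1)`. -/
theorem IsComodAlg.lTensor_PiL (hW : IsWeakHopf W) (hρ : IsComodAlg W ρ) (a : A) :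
    LinearMap.lTensor A (PiL W) (ρ a) = ρ 1 * (a ⊗ₜ[k] (1 : H)) := by
  let mulEval (s : A ⊗[k] H) : A ⊗[k] (H ⊗[k] H) →ₗ[k] A ⊗[k] H :=
    LinearMap.rTensor H ((TensorProduct.rid k A).toLinearMap ∘ₗ
      LinearMap.lTensor A W.ε ∘ₗ LinearMap.mulRight k s) ∘ₗ
      (TensorProduct.assoc k A H H).symm.toLinearMap
  have hl : ∀ (σ : H ⊗[k] H) (t s : A ⊗[k] H),
      LinearMap.lTensor A (dGen W (TensorProduct.comm k H H σ)) (t * s) =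
        mulEval s (LinearMap.lTensor A (LinearMap.mulLeft k σ ∘ₗ inA k H H) t) := by
    intro σ t s
    induction t with
    | zero => simp
    | add x y hx hy => simp only [map_add, add_mul, hx, hy]
    | tmul x y =>
      induction s with
      | zero => simp [mulEval]
      | add s t hs ht =>
        have hadd : mulEval (s + t) = mulEval s + mulEval t := by
          ext; simp [mulEval, mul_add, TensorProduct.add_tmul]
        rw [hadd, mul_add, map_add, hs, ht, LinearMap.add_apply]
      | tmul p q =>
        induction σ with
        | zero => simp
        | add σ τ hσ hτ =>
          simp only [map_add, dGen_add, LinearMap.lTensor_add, LinearMap.add_apply, hσ, hτ,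
            LinearMap.lTensor_tmul, LinearMap.comp_apply, LinearMap.mulLeft_apply, add_mul,
            TensorProduct.tmul_add]
        | tmul u v => simp [mulEval, TensorProduct.smul_tmul', mul_assoc]
  have hr : ∀ t : A ⊗[k] H,
      mulEval (ρ a) (TensorProduct.assoc k A H H (LinearMap.rTensor H ρ t)) =
        t * (a ⊗ₜ[k] (1 : H)) := by
    intro t
    induction t with
    | zero => simp
    | add x y hx hy => simp only [map_add, add_mul, hx, hy]
    | tmul x y => simp [mulEval, ← hρ.mul_compat, hρ.counit]
  rw [← hr, hρ.coassoc, hρ.lTensor_delta_one hW, ← hl, ← hρ.mul_compat, one_mul, PiL_eq_dGen]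

/-- `ρ ∘ e_A` is the map `h ↦ (1 ⊗ Π^R(h)) ρ(1)`. -/
theorem IsComodAlg.coaction_comp_eGen (hW : IsWeakHopf W) (hρ : IsComodAlg W ρ) :
    ρ ∘ₗ eGen W (ρ 1) = LinearMap.mulRight k (ρ 1) ∘ₗ inH k H A ∘ₗ PiR W := by
  ext h
  let evalLast : H ⊗[k] H →ₗ[k] H :=
    (TensorProduct.rid k H).toLinearMap ∘ₗ LinearMap.lTensor H (W.ε ∘ₗ LinearMap.mulLeft k h)
  have hl : ∀ t : A ⊗[k] H, ρ (eGen W t h) = LinearMap.lTensor A evalLast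
      (TensorProduct.assoc k A H H (LinearMap.rTensor H ρ t)) := by
    intro t
    induction t with
    | zero => simp
    | add x y hx hy => simp only [map_add, eGen_add, LinearMap.add_apply, hx, hy]
    | tmul x y =>
      simp only [eGen_tmul, map_smul, LinearMap.rTensor_tmul]
      generalize ρ x = s
      induction s with
      | zero => simp
      | add s t hs ht => simp only [map_add, smul_add, TensorProduct.add_tmul, hs, ht]
      | tmul p q => simp [evalLast]
  have hr : ∀ (σ : H ⊗[k] H) (y : H),
      evalLast (σ * (y ⊗ₜ[k] (1 : H))) = eGen W σ h * y := by
    intro σ y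
    induction σ with
    | zero => simp
    | add s t hs ht => simp only [map_add, eGen_add, LinearMap.add_apply, add_mul, hs, ht]
    | tmul p q => simp [evalLast]
  have hmul : evalLast ∘ₗ LinearMap.mulLeft k (W.δ 1) ∘ₗ inA k H H =
      LinearMap.mulLeft k (PiR W h) := by
    ext y
    simp [hr, PiR_eq_eGen]
  rw [LinearMap.comp_apply, hl, hρ.coassoc, hρ.lTensor_delta_one hW, ← LinearMap.comp_apply,
    ← LinearMap.lTensor_comp, hmul, lTensor_mulLeft]
  simp

/-- `Σ e_A(h₁) ⊗ h₂ = (1 ⊗ h) ρ(1)`. -/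
theorem IsComodAlg.conv_eGen_inH (hW : IsWeakHopf W) (hρ : IsComodAlg W ρ) :
    conv k W.δ (inA k H A ∘ₗ eGen W (ρ 1)) (inH k H A) =
      LinearMap.mulRight k (ρ 1) ∘ₗ inH k H A := by
  ext h
  have hl : ∀ (s : H ⊗[k] H) (t : A ⊗[k] H),
      TensorProduct.map (eGen W t) LinearMap.id s =
        LinearMap.lTensor A ((TensorProduct.lid k H).toLinearMap ∘ₗ LinearMap.rTensor H W.ε ∘ₗ
          LinearMap.mulLeft k s ∘ₗ inA k H H) t := by
    intro s t
    induction t with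
    | zero => simp
    | add x y hx hy =>
      simp only [map_add, eGen_add, TensorProduct.map_add_left, LinearMap.add_apply, hx, hy]
    | tmul x y =>
      induction s with
      | zero => simp
      | add s t hs ht =>
        simp only [LinearMap.lTensor_tmul, LinearMap.comp_apply, LinearMap.mulLeft_apply] at hs ht ⊢
        simp only [map_add, hs, ht, add_mul, TensorProduct.tmul_add]
      | tmul p q => simp [TensorProduct.smul_tmul']
  have hconv := LinearMap.congr_fun (conv_inA_inH (δ := W.δ) (eGen W (ρ 1)) LinearMap.id) h
  simp only [LinearMap.comp_id, LinearMap.comp_apply] at hconv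
  rw [hconv, hl, hρ.lTensor_coaction_one_congr (b := LinearMap.mulLeft k h), lTensor_mulLeft]
  · simp
  · intro x
    simpa using hW.counit_mul_PiL h x

/-- `Σ e_A(h₂) ⊗ Π^L(h₁) = Σ e_A(h₁) ⊗ Π^L(h₂)`. -/
theorem IsWeakHopf.conv_PiL_eGen_comm (hW : IsWeakHopf W) (t : A ⊗[k] H) :
    conv k W.δ (inH k H A ∘ₗ PiL W) (inA k H A ∘ₗ eGen W t) =
      conv k W.δ (inA k H A ∘ₗ eGen W t) (inH k H A ∘ₗ PiL W) := by
  have key : ∀ (σ : H ⊗[k] H) (h : H),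
      TensorProduct.map (eGen W t) (dGen W σ) (TensorProduct.comm k H H (W.δ h)) =
        TensorProduct.map (eGen W t) (dGen W σ) (W.δ h) := by
    intro σ h
    induction t with
    | zero => simp
    | add x y hx hy =>
      simp only [eGen_add, TensorProduct.map_add_left, LinearMap.add_apply, hx, hy]
    | tmul x y =>
      induction σ with
      | zero => simp
      | add s t hs ht =>
        simp only [dGen_add, TensorProduct.map_add_right, LinearMap.add_apply, hs, ht]
      | tmul p q =>
        have hmap : ∀ s : H ⊗[k] H,
            TensorProduct.map (eGen W (x ⊗ₜ[k] y)) (dGen W (p ⊗ₜ[k] q))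
                (TensorProduct.comm k H H s) =
              LinearMap.mul' k k ((TensorProduct.map (W.ε ∘ₗ LinearMap.mulLeft k q)
                (W.ε ∘ₗ LinearMap.mulRight k y)) s) • (x ⊗ₜ[k] p) := by
          intro s
          induction s with
          | zero => simp
          | add s t hs ht => simp only [map_add, add_smul, hs, ht]
          | tmul u v =>
            simp [TensorProduct.smul_tmul', TensorProduct.tmul_smul, smul_smul]
        have hswap := hmap (TensorProduct.comm k H H (W.δ h))
        rw [TensorProduct.comm_comm] at hswap
        rw [hmap, ← hW.a2, hswap, ← hW.a2']
  ext h
  rw [conv_inA_inH, conv_inH_inA, PiL_eq_dGen]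
  exact key _ h

end CleavingCoaction

/-- Let `H` be a weak Hopf algebra over a commutative ring `k`
and `(A, ρ)` a right `H`-comodule algebra such that `A_H ↪ A` is an `H`-cleft
extension with cleaving morphism `f` (with convolution inverse `finv`).  Then
`ρ ∘ f⁻¹ = (f⁻¹ ⊗ λ_H) ∘ c_{H,H} ∘ δ_H`. -/
theorem statement0 {k H A : Type} [CommRing k] [Ring H] [Algebra k H]
    [Ring A] [Algebra k A]
    (W : HopfData k H) (hW : IsWeakHopf W)
    (ρ : A →ₗ[k] A ⊗[k] H) (hρ : IsComodAlg W ρ)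
    (f finv : H →ₗ[k] A) (hf : IsCleaving W ρ f finv) :
    ∀ h : H, ρ (finv h) =
      (TensorProduct.map finv W.lam) ((TensorProduct.comm k H H) (W.δ h)) := by
  obtain ⟨hint, ⟨hc1, -, hc3⟩, hcoinv⟩ := hf
  have assoc := fun a b c : H →ₗ[k] A ⊗[k] H => conv_assoc hW.coassoc a b c
  have hρconv := fun a b : H →ₗ[k] A => comp_conv (δ := W.δ) ρ hρ.mul_compat a b
  have hPiL : conv k W.δ LinearMap.id W.lam = PiL W := LinearMap.ext hW.a4_left
  have hPiR : conv k W.δ W.lam LinearMap.id = PiR W := LinearMap.ext hW.a4_right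
  have hIL : conv k W.δ (inH k H A) (inH k H A ∘ₗ W.lam) = inH k H A ∘ₗ PiL W := by
    rw [← hPiL, inH_comp_conv, LinearMap.comp_id]
  have hLI : conv k W.δ (inH k H A ∘ₗ W.lam) (inH k H A) = inH k H A ∘ₗ PiR W := by
    rw [← hPiR, inH_comp_conv, LinearMap.comp_id]
  have hLPiL : conv k W.δ (inH k H A ∘ₗ W.lam) (inH k H A ∘ₗ PiL W) = inH k H A ∘ₗ W.lam := by
    rw [← inH_comp_conv, ← hPiL, ← conv_assoc hW.coassoc, hW.a4_mid]
  have hρf : ρ ∘ₗ f = conv k W.δ (inA k H A ∘ₗ f) (inH k H A) := by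
    rw [← LinearMap.comp_id (inH k H A), conv_inA_inH]
    exact LinearMap.ext hint
  set v : H →ₗ[k] A ⊗[k] H :=
    conv k W.δ (inH k H A ∘ₗ W.lam) (inA k H A ∘ₗ finv) with hv
  have hfPiL : conv k W.δ (inA k H A ∘ₗ f) (inH k H A ∘ₗ PiL W) =
      LinearMap.mulLeft k (ρ 1) ∘ₗ inA k H A ∘ₗ f := by
    ext h
    have hsplit : TensorProduct.map f (PiL W) (W.δ h) =
        LinearMap.lTensor A (PiL W) (LinearMap.rTensor H f (W.δ h)) := by
      rw [← LinearMap.lTensor_comp_rTensor, LinearMap.comp_apply]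
    rw [conv_inA_inH, LinearMap.comp_apply, hsplit, ← hint, hρ.lTensor_PiL hW]
    rfl
  have hright : conv k W.δ (ρ ∘ₗ f) v = conv k W.δ (ρ ∘ₗ f) (ρ ∘ₗ finv) := by
    rw [← hρconv, hρf, hv, assoc, ← assoc (inH k H A), hIL, ← assoc, hfPiL, conv_mulLeft_comp,
      ← inA_comp_conv]
    exact (LinearMap.ext hcoinv).symm
  have hE : conv k W.δ v (ρ ∘ₗ f) = conv k W.δ (inH k H A ∘ₗ W.lam)
      (conv k W.δ (inA k H A ∘ₗ eGen W (ρ 1)) (inH k H A)) := by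
    rw [hρf, hv, assoc, ← assoc (inA k H A ∘ₗ finv), ← inA_comp_conv, hc1]
  have hleft : conv k W.δ v (ρ ∘ₗ f) = conv k W.δ (ρ ∘ₗ finv) (ρ ∘ₗ f) := by
    rw [hE, hρ.conv_eGen_inH hW, conv_mulRight_comp, hLI, ← hρconv, hc1,
      hρ.coaction_comp_eGen hW]
  have hreg : conv k W.δ (conv k W.δ v (ρ ∘ₗ f)) v = v := by
    rw [hE, hv, assoc, assoc, ← assoc (inH k H A), hIL, ← assoc (inA k H A ∘ₗ eGen W (ρ 1)),
      ← hW.conv_PiL_eGen_comm, assoc, ← assoc, hLPiL, ← inA_comp_conv, ← hc1, hc3]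
  have hmain : ρ ∘ₗ finv = v := by
    rw [← hreg, hleft, assoc, hright, ← assoc, ← hρconv, ← hρconv, hc3]
  exact LinearMap.congr_fun (hmain.trans (conv_inH_inA finv W.lam))

end WHA

end
end

section
/- Let H be a cocommutative weak Hopf algebra over a commutative ring k and (A, ρ_A) a right H-comodule algebra. If there exists a convolution invertible integral f: H→A, then A_H ↪ A is an H-cleft extension; that is, the map f∧f^{-1}: H→A takes values in the subalgebra of coinvariants A_H. -/
open TensorProduct

noncomputable section

namespace WHA

variable (k : Type) [CommRing k]

variable (H : Type) [Ring H] [Algebra k H]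

variable {k H}

section Coinvariants

variable {A : Type} [Ring A] [Algebra k A]

/-- The map `x ⊗ y ↦ ε(y * h) • x`. -/
def sliceRight (W : HopfData k H) (M : Type) [AddCommGroup M] [Module k M] (h : H) :
    M ⊗[k] H →ₗ[k] M :=
  (TensorProduct.rid k M).toLinearMap ∘ₗ LinearMap.lTensor M (W.ε ∘ₗ LinearMap.mulRight k h)

/-- The map `x ⊗ y ↦ ε(x) • y`. -/
def sliceLeft (W : HopfData k H) : H ⊗[k] H →ₗ[k] H :=
  (TensorProduct.lid k H).toLinearMap ∘ₗ LinearMap.rTensor H W.ε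

/-- The pairing `(x, y) ↦ x₁ ε(x₂ y h)`. -/
def deltaPairing (W : HopfData k H) (h : H) : H →ₗ[k] H →ₗ[k] H :=
  (((LinearMap.mul k (H ⊗[k] H)).comp W.δ).compl₂ (TensorProduct.mk k H H 1)).compr₂
    (sliceRight W H h)

/-- The pairing `(x ⊗ z, y) ↦ ε(x y) z`. -/
def counitPairing (W : HopfData k H) : H ⊗[k] H →ₗ[k] H →ₗ[k] H :=
  ((LinearMap.mul k (H ⊗[k] H)).compl₂ ((TensorProduct.mk k H H).flip 1)).compr₂ (sliceLeft W)

@[simp] lemma sliceRight_tmul (W : HopfData k H) {M : Type} [AddCommGroup M] [Module k M]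
    (h : H) (m : M) (x : H) : sliceRight W M h (m ⊗ₜ x) = W.ε (x * h) • m := by
  simp [sliceRight]

@[simp] lemma sliceLeft_tmul (W : HopfData k H) (x y : H) :
    sliceLeft W (x ⊗ₜ y) = W.ε x • y := by
  simp [sliceLeft]

lemma deltaPairing_apply (W : HopfData k H) (h x y : H) :
    deltaPairing W h x y = sliceRight W H h (W.δ x * ((1 : H) ⊗ₜ[k] y)) := by
  simp [deltaPairing]

@[simp] lemma counitPairing_tmul (W : HopfData k H) (x y z : H) :
    counitPairing W (x ⊗ₜ z) y = W.ε (x * y) • z := by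
  simp [counitPairing]

lemma dGen_apply (W : HopfData k H) {B : Type} [AddCommGroup B] [Module k B]
    (t : B ⊗[k] H) (h : H) : dGen W t h = sliceRight W B h t := by
  induction t with
  | zero => simp [dGen]
  | tmul b x => simp [dGen]
  | add s t hs ht =>
    simp only [dGen, LinearMap.comp_apply, map_add, LinearMap.add_apply] at hs ht ⊢
    rw [hs, ht]

lemma PiL_eq_sliceRight {W : HopfData k H} (hcc : Cocomm W) (t : H) :
    PiL W t = sliceRight W H t (W.δ 1) := by
  have key : ∀ w : H ⊗[k] H,
      (TensorProduct.rid k H) (LinearMap.lTensor H (W.ε ∘ₗ LinearMap.mul' k H)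
        (TensorProduct.assoc k H H H (LinearMap.rTensor H
          (TensorProduct.comm k H H).toLinearMap (w ⊗ₜ t)))) =
      sliceRight W H t (TensorProduct.comm k H H w) := by
    intro w
    induction w with
    | zero => simp
    | tmul x y => simp
    | add u v hu hv => simp only [add_tmul, map_add, hu, hv]
  rw [← hcc 1, ← key]
  simp [PiL, hcc 1]

/-- In a cocommutative weak Hopf algebra, `δ(y) = δ(1)(1 ⊗ y)` on the image of `Π^L`. -/
lemma comul_PiL {W : HopfData k H} (hW : IsWeakHopf W) (hcc : Cocomm W) (t : H) :
    W.δ (PiL W t) = W.δ 1 * ((1 : H) ⊗ₜ[k] PiL W t) := by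
  have left : ∀ w : H ⊗[k] H, W.δ (sliceRight W H t w) =
      LinearMap.lTensor H (sliceRight W H t)
        (TensorProduct.assoc k H H H (LinearMap.rTensor H W.δ w)) := by
    intro w
    induction w with
    | zero => simp
    | tmul x y =>
      simp only [sliceRight_tmul, map_smul, LinearMap.rTensor_tmul]
      generalize W.δ x = v
      induction v with
      | zero => simp
      | tmul a b => simp
      | add u v hu hv => simp only [add_tmul, map_add, smul_add, hu, hv]
    | add u v hu hv => simp only [map_add, hu, hv]
  have right : ∀ u v : H ⊗[k] H, LinearMap.lTensor H (sliceRight W H t)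
      ((TensorProduct.map LinearMap.id
        (Algebra.TensorProduct.includeLeft : H →ₐ[k] H ⊗[k] H).toLinearMap) u *
      (Algebra.TensorProduct.includeRight : (H ⊗[k] H) →ₐ[k] H ⊗[k] (H ⊗[k] H)).toLinearMap v) =
      u * ((1 : H) ⊗ₜ[k] sliceRight W H t v) := by
    intro u v
    induction u with
    | zero => simp
    | add u u' hu hu' => simp only [map_add, add_mul, hu, hu']
    | tmul a b =>
      induction v with
      | zero => simp
      | add u v hu hv => simp only [map_add, mul_add, tmul_add, hu, hv]
      | tmul c d => simp
  rw [PiL_eq_sliceRight hcc, left, hW.a3, right]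

/-- `y₁ ε(y₂ h)` paired with `x` by the counit gives `ε(x y h)`. -/
lemma counit_mul_sliceRight_comul {W : HopfData k H} (hW : IsWeakHopf W) (h x y : H) :
    W.ε (x * sliceRight W H h (W.δ y)) = W.ε (x * y * h) := by
  rw [hW.a2]
  generalize W.δ y = w
  induction w with
  | zero => simp
  | tmul a b => simp [mul_comm]
  | add u v hu hv => simp only [map_add, mul_add, hu, hv]

lemma counitPairing_comul {W : HopfData k H} (hW : IsWeakHopf W) (hcc : Cocomm W) (h x y : H) :
    counitPairing W (W.δ x) (sliceRight W H h (W.δ y)) = deltaPairing W h x y := by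
  have key : ∀ w : H ⊗[k] H, counitPairing W w (sliceRight W H h (W.δ y)) =
      sliceRight W H h (TensorProduct.comm k H H w * ((1 : H) ⊗ₜ[k] y)) := by
    intro w
    induction w with
    | zero => simp
    | tmul a b => simp [counit_mul_sliceRight_comul hW]
    | add u v hu hv => simp only [map_add, add_mul, LinearMap.add_apply, hu, hv]
  rw [key, hcc, deltaPairing_apply]

lemma sliceRight_comul_mul_PiL {W : HopfData k H} (hW : IsWeakHopf W) (hcc : Cocomm W)
    (h x t : H) :
    sliceRight W H h (W.δ (x * PiL W t)) = deltaPairing W h x (PiL W t) := by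
  rw [deltaPairing_apply, hW.a1, comul_PiL hW hcc, ← mul_assoc, ← hW.a1, mul_one]

lemma lTensor_sliceRight_comul_mul {W : HopfData k H} (hW : IsWeakHopf W) (hcc : Cocomm W)
    (h : H) (u v : A ⊗[k] H) :
    LinearMap.lTensor A (sliceRight W H h ∘ₗ W.δ) (u * LinearMap.lTensor A (PiL W) v) =
      TensorProduct.map₂ (LinearMap.mul k A) (deltaPairing W h) u
        (LinearMap.lTensor A (PiL W) v) := by
  induction u with
  | zero => simp
  | add u u' hu hu' => simp only [map_add, add_mul, LinearMap.add_apply, hu, hu']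
  | tmul a x =>
    induction v with
    | zero => simp
    | add u v hu hv => simp only [map_add, mul_add, hu, hv]
    | tmul b y => simp [sliceRight_comul_mul_PiL hW hcc]

lemma map₂_counitPairing {W : HopfData k H} (hW : IsWeakHopf W) (hcc : Cocomm W)
    (h : H) (u v : A ⊗[k] H) :
    TensorProduct.map₂ (LinearMap.mul k A) (counitPairing W) (LinearMap.lTensor A W.δ u)
        (LinearMap.lTensor A (sliceRight W H h ∘ₗ W.δ) v) =
      TensorProduct.map₂ (LinearMap.mul k A) (deltaPairing W h) u v := by
  induction u with
  | zero => simp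
  | add u u' hu hu' => simp only [map_add, LinearMap.add_apply, hu, hu']
  | tmul a x =>
    induction v with
    | zero => simp
    | add u v hu hv => simp only [map_add, hu, hv]
    | tmul b y => simp [counitPairing_comul hW hcc]

lemma coaction_sliceRight {W : HopfData k H} {ρ : A →ₗ[k] A ⊗[k] H} (hρ : IsComodAlg W ρ)
    (h : H) (a : A) :
    ρ (sliceRight W A h (ρ a)) = LinearMap.lTensor A (sliceRight W H h ∘ₗ W.δ) (ρ a) := by
  have key : ∀ w : A ⊗[k] H, ρ (sliceRight W A h w) =
      LinearMap.lTensor A (sliceRight W H h)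
        (TensorProduct.assoc k A H H (LinearMap.rTensor H ρ w)) := by
    intro w
    induction w with
    | zero => simp
    | tmul x y =>
      simp only [sliceRight_tmul, map_smul, LinearMap.rTensor_tmul]
      generalize ρ x = v
      induction v with
      | zero => simp
      | tmul a b => simp
      | add u v hu hv => simp only [add_tmul, map_add, smul_add, hu, hv]
    | add u v hu hv => simp only [map_add, hu, hv]
  rw [key, hρ.coassoc, LinearMap.lTensor_comp_apply]

lemma mul_tmul_one_eq_map₂ {W : HopfData k H} {ρ : A →ₗ[k] A ⊗[k] H} (hρ : IsComodAlg W ρ)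
    (u : A ⊗[k] H) (b : A) :
    u * (b ⊗ₜ[k] (1 : H)) = TensorProduct.map₂ (LinearMap.mul k A) (counitPairing W)
      (TensorProduct.assoc k A H H (LinearMap.rTensor H ρ u)) (ρ b) := by
  have key : ∀ (v w : A ⊗[k] H) (x : H),
      TensorProduct.map₂ (LinearMap.mul k A) (counitPairing W)
        (TensorProduct.assoc k A H H (v ⊗ₜ x)) w =
      (TensorProduct.rid k A (LinearMap.lTensor A W.ε (v * w))) ⊗ₜ[k] x := by
    intro v w x
    induction v with
    | zero => simp
    | add u u' hu hu' => simp only [map_add, add_tmul, add_mul, LinearMap.add_apply, hu, hu']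
    | tmul a y =>
      induction w with
      | zero => simp
      | add u v hu hv => simp only [map_add, mul_add, add_tmul, hu, hv]
      | tmul c z => simp [TensorProduct.smul_tmul]
  induction u with
  | zero => simp
  | add u v hu hv => simp only [map_add, add_mul, LinearMap.add_apply, hu, hv]
  | tmul a x =>
    rw [LinearMap.rTensor_tmul, key, ← hρ.mul_compat, hρ.counit]
    simp

/-- For cocommutative `H`, the elements `1₀ ε(1₁ h)` of a comodule algebra are coinvariant. -/
lemma isCoinv_dGen {W : HopfData k H} (hW : IsWeakHopf W) (hcc : Cocomm W)
    {ρ : A →ₗ[k] A ⊗[k] H} (hρ : IsComodAlg W ρ) (h : H) : IsCoinv ρ (dGen W (ρ 1) h) := by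
  have hone : ρ 1 = ρ 1 * LinearMap.lTensor A (PiL W) (ρ 1) := by
    rw [hρ.unit_coinv, ← hρ.mul_compat, mul_one]
  unfold IsCoinv zeta
  rw [dGen_apply, mul_tmul_one_eq_map₂ hρ, coaction_sliceRight hρ, hρ.coassoc,
    map₂_counitPairing hW hcc]
  conv_lhs => rw [hone]
  rw [lTensor_sliceRight_comul_mul hW hcc, hρ.unit_coinv]

end Coinvariants

/-- Let `H` be a cocommutative weak Hopf algebra and `(A, ρ)`
a right `H`-comodule algebra.  If there exists a convolution invertible
integral `f : H → A`, then `A_H ↪ A` is an `H`-cleft extension, i.e. `f ∧ f⁻¹`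
takes values in the subalgebra of coinvariants `A_H`. -/
theorem statement1 {k H A : Type} [CommRing k] [Ring H] [Algebra k H]
    [Ring A] [Algebra k A]
    (W : HopfData k H) (hW : IsWeakHopf W) (hcc : Cocomm W)
    (ρ : A →ₗ[k] A ⊗[k] H) (hρ : IsComodAlg W ρ)
    (f finv : H →ₗ[k] A) (hf : IsIntegral W ρ f) (hinv : IsConvInv W ρ f finv) :
    ∀ h : H, IsCoinv ρ (conv k W.δ f finv h) := by
  intro h
  rw [hinv.2.1]
  exact isCoinv_dGen hW hcc hρ h

end WHA

end
end

section
/- Let H be a cocommutative weak Hopf algebra over a commutative ring k and A a unital associative k-algebra. Then the relation ≈ on crossed systems for H over A is an equivalence relation (reflexive, symmetric, and transitive). -/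
open TensorProduct

noncomputable section

namespace WHA

variable (k : Type) [CommRing k]

variable (H : Type) [Ring H] [Algebra k H]

variable {k H}

section Convolution

variable {C A : Type} [AddCommGroup C] [Module k C] [Ring A] [Algebra k A]

lemma conv_apply_s6 (δC : C →ₗ[k] C ⊗[k] C) (f g : C →ₗ[k] A) (x : C) :
    conv k δC f g x = LinearMap.mul' k A (TensorProduct.map f g (δC x)) := rfl

/-- Convolution over a coassociative comultiplication is associative. -/
lemma conv_assoc_s6 {δC : C →ₗ[k] C ⊗[k] C}
    (hδ : ∀ x, TensorProduct.assoc k C C C (LinearMap.rTensor C δC (δC x)) =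
      LinearMap.lTensor C δC (δC x)) (f g l : C →ₗ[k] A) :
    conv k δC (conv k δC f g) l = conv k δC f (conv k δC g l) := by
  ext x
  have key : ∀ X : (C ⊗[k] C) ⊗[k] C,
      LinearMap.mul' k A (TensorProduct.map (LinearMap.mul' k A ∘ₗ TensorProduct.map f g) l X) =
        LinearMap.mul' k A (TensorProduct.map f (LinearMap.mul' k A ∘ₗ TensorProduct.map g l)
          (TensorProduct.assoc k C C C X)) := by
    intro X
    induction X with
    | zero => simp
    | add X Y hX hY => simp only [map_add, hX, hY]
    | tmul X c =>
      induction X with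
      | zero => simp
      | add X Y hX hY => simp only [TensorProduct.add_tmul, map_add, hX, hY]
      | tmul a b => simp [mul_assoc]
  have h := key (LinearMap.rTensor C δC (δC x))
  rw [hδ] at h
  rw [LinearMap.rTensor, LinearMap.lTensor, TensorProduct.map_map, TensorProduct.map_map] at h
  exact h

end Convolution

section TensorSquare

variable {A : Type} [Ring A] [Algebra k A] {W : HopfData k H}

lemma δ2_coassoc (hW : IsWeakHopf W) (x : H ⊗[k] H) :
    TensorProduct.assoc k _ _ _ (LinearMap.rTensor (H ⊗[k] H) (δ2 W) (δ2 W x)) =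
      LinearMap.lTensor (H ⊗[k] H) (δ2 W) (δ2 W x) := by
  let _ : Coalgebra k H :=
    { comul := W.δ
      counit := W.ε
      coassoc := LinearMap.ext hW.coassoc
      rTensor_counit_comp_comul := LinearMap.ext fun h =>
        (TensorProduct.lid k H).injective (by simpa using hW.counit_left h)
      lTensor_counit_comp_comul := LinearMap.ext fun h =>
        (TensorProduct.rid k H).injective (by simpa using hW.counit_right h) }
  exact Coalgebra.coassoc_apply (R := k) x

/-- The extension `x ⊗ y ↦ ε(y) f(x)` of `f : H → A` to `H ⊗ H`. -/
def extendLeft (W : HopfData k H) (f : H →ₗ[k] A) : H ⊗[k] H →ₗ[k] A :=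
  (TensorProduct.rid k A).toLinearMap ∘ₗ TensorProduct.map f W.ε

/-- Convolving on the left with `extendLeft W f` is convolving with `f` in the first variable. -/
lemma conv_extendLeft_tmul (hW : IsWeakHopf W) (f : H →ₗ[k] A) (G : H ⊗[k] H →ₗ[k] A)
    (x y : H) : conv k (δ2 W) (extendLeft W f) G (x ⊗ₜ y) =
      conv k W.δ f (G ∘ₗ (TensorProduct.mk k H H).flip y) x := by
  have key : ∀ X Y : H ⊗[k] H,
      LinearMap.mul' k A (TensorProduct.map (extendLeft W f) G
        (TensorProduct.tensorTensorTensorComm k H H H H (X ⊗ₜ Y))) =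
      LinearMap.mul' k A (TensorProduct.map f (G ∘ₗ (TensorProduct.mk k H H).flip
        (TensorProduct.lid k H (LinearMap.rTensor H W.ε Y))) X) := by
    intro X Y
    induction X with
    | zero => simp
    | add X X' hX hX' => simp only [TensorProduct.add_tmul, map_add, hX, hX']
    | tmul a b =>
      induction Y with
      | zero => simp
      | add Y Y' hY hY' =>
        simp only [TensorProduct.tmul_add, map_add, hY, hY', TensorProduct.map_tmul,
          LinearMap.comp_apply, LinearMap.add_apply, LinearMap.mul'_apply]
      | tmul c d => simp [extendLeft]
  have h := key (W.δ x) (W.δ y)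
  rwa [hW.counit_left] at h

/-- Convolving on the right with `extendLeft W f` is convolving with `f` in the first variable. -/
lemma conv_tmul_extendLeft (hW : IsWeakHopf W) (f : H →ₗ[k] A) (G : H ⊗[k] H →ₗ[k] A)
    (x y : H) : conv k (δ2 W) G (extendLeft W f) (x ⊗ₜ y) =
      conv k W.δ (G ∘ₗ (TensorProduct.mk k H H).flip y) f x := by
  have key : ∀ X Y : H ⊗[k] H,
      LinearMap.mul' k A (TensorProduct.map G (extendLeft W f)
        (TensorProduct.tensorTensorTensorComm k H H H H (X ⊗ₜ Y))) =
      LinearMap.mul' k A (TensorProduct.map (G ∘ₗ (TensorProduct.mk k H H).flip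
        (TensorProduct.rid k H (LinearMap.lTensor H W.ε Y))) f X) := by
    intro X Y
    induction X with
    | zero => simp
    | add X X' hX hX' => simp only [TensorProduct.add_tmul, map_add, hX, hX']
    | tmul a b =>
      induction Y with
      | zero => simp
      | add Y Y' hY hY' =>
        simp only [TensorProduct.tmul_add, map_add, hY, hY', TensorProduct.map_tmul,
          LinearMap.comp_apply, LinearMap.add_apply, LinearMap.mul'_apply, add_mul]
      | tmul c d => simp [extendLeft]
  have h := key (W.δ x) (W.δ y)
  rwa [hW.counit_right] at h

lemma extendLeft_comp_flip (f : H →ₗ[k] A) (y : H) :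
    extendLeft W f ∘ₗ (TensorProduct.mk k H H).flip y = W.ε y • f := by
  ext x; simp [extendLeft]

lemma conv_extendLeft (hW : IsWeakHopf W) (f g : H →ₗ[k] A) :
    conv k (δ2 W) (extendLeft W f) (extendLeft W g) = extendLeft W (conv k W.δ f g) := by
  refine TensorProduct.ext' fun x y => ?_
  rw [conv_extendLeft_tmul hW, extendLeft_comp_flip]
  simp [conv_apply_s6, extendLeft, TensorProduct.map_smul_right]

lemma conv_comp_mul' (hW : IsWeakHopf W) (f g : H →ₗ[k] A) :
    conv k (δ2 W) (f ∘ₗ LinearMap.mul' k H) (g ∘ₗ LinearMap.mul' k H) =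
      conv k W.δ f g ∘ₗ LinearMap.mul' k H := by
  refine TensorProduct.ext' fun x y => ?_
  have key : ∀ X Y : H ⊗[k] H,
      LinearMap.mul' k A (TensorProduct.map (f ∘ₗ LinearMap.mul' k H) (g ∘ₗ LinearMap.mul' k H)
        (TensorProduct.tensorTensorTensorComm k H H H H (X ⊗ₜ Y))) =
      LinearMap.mul' k A (TensorProduct.map f g (X * Y)) := by
    intro X Y
    induction X with
    | zero => simp
    | add X X' hX hX' => simp only [TensorProduct.add_tmul, map_add, hX, hX', add_mul]
    | tmul a b =>
      induction Y with
      | zero => simp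
      | add Y Y' hY hY' => simp only [TensorProduct.tmul_add, map_add, hY, hY', mul_add]
      | tmul c d => simp
  have h := key (W.δ x) (W.δ y)
  rwa [← hW.a1] at h

end TensorSquare

section WeakAction

variable {A : Type} [Ring A] [Algebra k A] {W : HopfData k H} {φ ϕ : H ⊗[k] A →ₗ[k] A}

lemma IsWeakModAlg.conv_flip (hφ : IsWeakModAlg W φ) (b c : A) :
    conv k W.δ (φ ∘ₗ (TensorProduct.mk k H A).flip b) (φ ∘ₗ (TensorProduct.mk k H A).flip c) =
      φ ∘ₗ (TensorProduct.mk k H A).flip (b * c) :=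
  LinearMap.ext fun x => (hφ.2.1 x b c).symm

lemma IsWeakModAlg.conv_u1_flip (hφ : IsWeakModAlg W φ) (b : A) :
    conv k W.δ (u1 φ) (φ ∘ₗ (TensorProduct.mk k H A).flip b) =
      φ ∘ₗ (TensorProduct.mk k H A).flip b := by
  simpa [u1] using hφ.conv_flip 1 b

lemma IsWeakModAlg.conv_flip_u1 (hφ : IsWeakModAlg W φ) (b : A) :
    conv k W.δ (φ ∘ₗ (TensorProduct.mk k H A).flip b) (u1 φ) =
      φ ∘ₗ (TensorProduct.mk k H A).flip b := by
  simpa [u1] using hφ.conv_flip b 1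

lemma IsWeakModAlg.conv_u1_u1 (hφ : IsWeakModAlg W φ) :
    conv k W.δ (u1 φ) (u1 φ) = u1 φ := hφ.conv_u1_flip 1

lemma IsWeakModAlg.u1_one (hφ : IsWeakModAlg W φ) : u1 φ 1 = 1 := hφ.1 1

/-- The action `x ⊗ y ↦ φ(x ⊗ f(y))` is multiplicative in `f` for the convolution products. -/
lemma IsWeakModAlg.conv_lTensor (hφ : IsWeakModAlg W φ) (f g : H →ₗ[k] A) :
    conv k (δ2 W) (φ ∘ₗ LinearMap.lTensor H f) (φ ∘ₗ LinearMap.lTensor H g) =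
      φ ∘ₗ LinearMap.lTensor H (conv k W.δ f g) := by
  refine TensorProduct.ext' fun x y => ?_
  have key : ∀ Y : H ⊗[k] H,
      LinearMap.mul' k A (TensorProduct.map (φ ∘ₗ LinearMap.lTensor H f)
        (φ ∘ₗ LinearMap.lTensor H g)
        (TensorProduct.tensorTensorTensorComm k H H H H (W.δ x ⊗ₜ Y))) =
      φ (x ⊗ₜ LinearMap.mul' k A (TensorProduct.map f g Y)) := by
    intro Y
    induction Y with
    | zero => simp
    | add Y Y' hY hY' => simp only [TensorProduct.tmul_add, map_add, hY, hY']
    | tmul c d =>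
      rw [TensorProduct.map_tmul, LinearMap.mul'_apply, hφ.2.1]
      generalize W.δ x = X
      induction X with
      | zero => simp
      | add X X' hX hX' => simp only [TensorProduct.add_tmul, map_add, hX, hX']
      | tmul a b => simp
  exact key (W.δ y)

lemma lTensor_comp_flip (f : H →ₗ[k] A) (y : H) :
    (φ ∘ₗ LinearMap.lTensor H f) ∘ₗ (TensorProduct.mk k H H).flip y =
      φ ∘ₗ (TensorProduct.mk k H A).flip (f y) := by
  ext x; simp

lemma IsWeakModAlg.conv_extendLeft_u1_lTensor (hW : IsWeakHopf W) (hφ : IsWeakModAlg W φ)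
    (f : H →ₗ[k] A) :
    conv k (δ2 W) (extendLeft W (u1 φ)) (φ ∘ₗ LinearMap.lTensor H f) =
      φ ∘ₗ LinearMap.lTensor H f := by
  refine TensorProduct.ext' fun x y => ?_
  rw [conv_extendLeft_tmul hW, lTensor_comp_flip, hφ.conv_u1_flip]
  simp

lemma IsWeakModAlg.lTensor_u1 (hφ : IsWeakModAlg W φ) :
    φ ∘ₗ LinearMap.lTensor H (u1 φ) = u2 φ :=
  TensorProduct.ext' fun x y => (hφ.2.2.1 x y).symm

lemma fisEq_iff {h hinv : H →ₗ[k] A} : FisEq W φ ϕ h hinv ↔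
    ∀ b : A, φ ∘ₗ (TensorProduct.mk k H A).flip b =
      conv k W.δ (conv k W.δ h (ϕ ∘ₗ (TensorProduct.mk k H A).flip b)) hinv := by
  have key : ∀ (b : A) (X : H ⊗[k] H),
      (LinearMap.mul' k A ∘ₗ LinearMap.rTensor A (LinearMap.mul' k A))
        ((TensorProduct.map (TensorProduct.map h (ϕ ∘ₗ (TensorProduct.mk k H A).flip b)) hinv)
          ((LinearMap.rTensor H W.δ) X)) =
      LinearMap.mul' k A (TensorProduct.map
        (conv k W.δ h (ϕ ∘ₗ (TensorProduct.mk k H A).flip b)) hinv X) := by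
    intro b X
    induction X with
    | zero => simp
    | add X X' hX hX' => simp only [map_add, hX, hX']
    | tmul a c => simp [conv_apply_s6]
  constructor
  · intro hF b
    ext x
    exact (hF x b).trans (key b _)
  · intro hF x b
    exact (LinearMap.congr_fun (hF b) x).trans (key b _).symm

lemma FisEq.lTensor_eq (hW : IsWeakHopf W) {h hinv : H →ₗ[k] A} (hF : FisEq W φ ϕ h hinv)
    (f : H →ₗ[k] A) : φ ∘ₗ LinearMap.lTensor H f =
      conv k (δ2 W) (conv k (δ2 W) (extendLeft W h) (ϕ ∘ₗ LinearMap.lTensor H f))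
        (extendLeft W hinv) := by
  refine TensorProduct.ext' fun x y => ?_
  rw [conv_tmul_extendLeft hW]
  have : conv k (δ2 W) (extendLeft W h) (ϕ ∘ₗ LinearMap.lTensor H f) ∘ₗ
      (TensorProduct.mk k H H).flip y =
      conv k W.δ h (ϕ ∘ₗ (TensorProduct.mk k H A).flip (f y)) := by
    ext z
    simpa [lTensor_comp_flip] using conv_extendLeft_tmul hW h (ϕ ∘ₗ LinearMap.lTensor H f) z y
  rw [this, ← fisEq_iff.1 hF]
  simp

lemma sigmasEq_iff (hW : IsWeakHopf W) {σ τ : H ⊗[k] H →ₗ[k] A} {h hinv : H →ₗ[k] A} :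
    SigmasEq W ϕ σ τ h hinv ↔ σ = conv k (δ2 W)
      (conv k (δ2 W) (extendLeft W h) (ϕ ∘ₗ LinearMap.lTensor H h))
      (conv k (δ2 W) τ (hinv ∘ₗ LinearMap.mul' k H)) := by
  have : LinearMap.mul' k A ∘ₗ TensorProduct.map h ϕ
      ∘ₗ (TensorProduct.assoc k H H A).toLinearMap ∘ₗ TensorProduct.map W.δ h =
      conv k (δ2 W) (extendLeft W h) (ϕ ∘ₗ LinearMap.lTensor H h) := by
    refine TensorProduct.ext' fun x y => ?_
    rw [conv_extendLeft_tmul hW, lTensor_comp_flip, conv_apply_s6]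
    simp only [LinearMap.comp_apply, TensorProduct.map_tmul, LinearEquiv.coe_coe]
    generalize W.δ x = X
    induction X with
    | zero => simp
    | add X X' hX hX' => simp only [TensorProduct.add_tmul, map_add, hX, hX']
    | tmul a b => simp
  rw [SigmasEq, this]

end WeakAction

section Regular

variable {A : Type} [Ring A] [Algebra k A] {W : HopfData k H} {φ : H ⊗[k] A →ₗ[k] A}

/-- The second leg of `δ 1` is fixed by the target map. -/
lemma lTensor_PiL_δ_one (hW : IsWeakHopf W) : LinearMap.lTensor H (PiL W) (W.δ 1) = W.δ 1 := by
  have key : ∀ X Y : H ⊗[k] H,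
      LinearMap.lTensor H ((TensorProduct.lid k H).toLinearMap ∘ₗ LinearMap.rTensor H W.ε)
        ((Algebra.TensorProduct.includeRight : (H ⊗[k] H) →ₐ[k] H ⊗[k] (H ⊗[k] H)).toLinearMap Y *
          TensorProduct.map LinearMap.id
            (Algebra.TensorProduct.includeLeft : H →ₐ[k] H ⊗[k] H).toLinearMap X) =
      LinearMap.lTensor H ((TensorProduct.rid k H).toLinearMap
        ∘ₗ LinearMap.lTensor H (W.ε ∘ₗ LinearMap.mul' k H)
        ∘ₗ (TensorProduct.assoc k H H H).toLinearMap
        ∘ₗ LinearMap.rTensor H (TensorProduct.comm k H H).toLinearMap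
        ∘ₗ TensorProduct.mk k (H ⊗[k] H) H Y) X := by
    intro X Y
    induction X with
    | zero => simp
    | add X X' hX hX' => simp only [map_add, hX, hX', mul_add]
    | tmul a b =>
      induction Y with
      | zero => simp
      | add Y Y' hY hY' =>
        simp only [map_add, hY, hY', add_mul, LinearMap.lTensor_tmul, LinearMap.comp_apply,
          LinearMap.add_apply, TensorProduct.tmul_add]
      | tmul c d => simp
  have h := key (W.δ 1) (W.δ 1)
  rw [← hW.a3', hW.coassoc] at h
  refine h.symm.trans ?_
  rw [← LinearMap.comp_apply, ← LinearMap.lTensor_comp]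
  have hid : ((TensorProduct.lid k H).toLinearMap ∘ₗ LinearMap.rTensor H W.ε) ∘ₗ W.δ =
      LinearMap.id := LinearMap.ext hW.counit_left
  rw [hid, LinearMap.lTensor_id, LinearMap.id_apply]

/-- A map absorbing `u₁` on the right and normalized at `1` agrees with `u₁` on the first leg
of `δ 1`. -/
lemma rTensor_δ_one_eq (hW : IsWeakHopf W) (hφ : IsWeakModAlg W φ) {h : H →ₗ[k] A}
    (hu : conv k W.δ h (u1 φ) = h) (h1 : h 1 = 1) :
    LinearMap.rTensor H h (W.δ 1) = LinearMap.rTensor H (u1 φ) (W.δ 1) := by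
  have split : ∀ (X Y : H ⊗[k] H),
      TensorProduct.map (LinearMap.mul' k A ∘ₗ TensorProduct.map h (u1 φ)) LinearMap.id
        ((TensorProduct.assoc k H H H).symm
          (TensorProduct.map LinearMap.id
              (Algebra.TensorProduct.includeLeft : H →ₐ[k] H ⊗[k] H).toLinearMap
              (LinearMap.lTensor H (PiL W) X) *
            (Algebra.TensorProduct.includeRight :
              (H ⊗[k] H) →ₐ[k] H ⊗[k] (H ⊗[k] H)).toLinearMap Y)) =
      LinearMap.rTensor H (LinearMap.mulLeft k
        (LinearMap.mul' k A (TensorProduct.map h (u1 φ) X)) ∘ₗ u1 φ) Y := by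
    intro X Y
    induction X with
    | zero => simp
    | add X X' hX hX' =>
      have hmul (a b : A) : LinearMap.mulLeft k (a + b) =
          LinearMap.mulLeft k a + LinearMap.mulLeft k b := by ext; simp [add_mul]
      rw [map_add, map_add, add_mul, map_add, map_add, hX, hX', map_add, map_add, hmul,
        LinearMap.add_comp, LinearMap.rTensor_add, LinearMap.add_apply]
    | tmul a b =>
      induction Y with
      | zero => simp
      | add Y Y' hY hY' => simp only [map_add, mul_add, hY, hY']
      | tmul c d =>
        have e : u1 φ (PiL W b * c) = u1 φ b * u1 φ c :=
          (hφ.2.2.1 _ _).trans (hφ.2.2.2 _ _)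
        simp [e]
  have hs := split (W.δ 1) (W.δ 1)
  rw [lTensor_PiL_δ_one hW, ← hW.a3, LinearEquiv.symm_apply_apply, ← conv_apply_s6, hu, h1,
    LinearMap.mulLeft_one, LinearMap.id_comp] at hs
  rw [← hs, LinearMap.rTensor, LinearMap.rTensor, TensorProduct.map_map, LinearMap.id_comp]
  change _ = TensorProduct.map (conv k W.δ h (u1 φ)) LinearMap.id (W.δ 1)
  rw [hu]

lemma conv_apply_one (hW : IsWeakHopf W) (hφ : IsWeakModAlg W φ) {h l : H →ₗ[k] A}
    (hu : conv k W.δ h (u1 φ) = h) (h1 : h 1 = 1) (ul : conv k W.δ (u1 φ) l = l) :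
    conv k W.δ h l 1 = l 1 := by
  have e : ∀ f : H →ₗ[k] A, conv k W.δ f l 1 =
      LinearMap.mul' k A (LinearMap.lTensor A l (LinearMap.rTensor H f (W.δ 1))) := by
    intro f
    rw [conv_apply_s6, ← LinearMap.comp_apply (LinearMap.lTensor A l), LinearMap.lTensor_comp_rTensor]
  rw [e, rTensor_δ_one_eq hW hφ hu h1, ← e, ul]

lemma IsRegPair.symm {h hinv : H →ₗ[k] A} (hr : IsRegPair W φ h hinv) :
    IsRegPair W φ hinv h := ⟨hr.2.1, hr.1, hr.2.2.2, hr.2.2.1⟩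

lemma IsRegPair.u1_conv {h hinv : H →ₗ[k] A} (hr : IsRegPair W φ h hinv) :
    conv k W.δ (u1 φ) h = h := by rw [← hr.1]; exact hr.2.2.1

lemma IsRegPair.conv_u1 (hW : IsWeakHopf W) {h hinv : H →ₗ[k] A}
    (hr : IsRegPair W φ h hinv) : conv k W.δ h (u1 φ) = h := by
  rw [← hr.2.1, ← conv_assoc_s6 hW.coassoc]; exact hr.2.2.1

lemma IsRegPair.inv_one (hW : IsWeakHopf W) (hφ : IsWeakModAlg W φ) {h hinv : H →ₗ[k] A}
    (hr : IsRegPair W φ h hinv) (h1 : h 1 = 1) : hinv 1 = 1 := by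
  rw [← conv_apply_one hW hφ (hr.conv_u1 hW) h1 hr.symm.u1_conv, hr.1, hφ.u1_one]

lemma IsRegPair.conv (hW : IsWeakHopf W) {h hinv l linv : H →ₗ[k] A}
    (hr : IsRegPair W φ h hinv) (lr : IsRegPair W φ l linv) :
    IsRegPair W φ (conv k W.δ h l) (conv k W.δ linv hinv) := by
  have assoc := conv_assoc_s6 (A := A) hW.coassoc
  have e₁ : WHA.conv k W.δ (WHA.conv k W.δ h l) (WHA.conv k W.δ linv hinv) = u1 φ := by
    rw [assoc, ← assoc l, lr.1, hr.symm.u1_conv, hr.1]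
  have e₂ : WHA.conv k W.δ (WHA.conv k W.δ linv hinv) (WHA.conv k W.δ h l) = u1 φ := by
    rw [assoc, ← assoc hinv, hr.2.1, lr.u1_conv, lr.2.1]
  exact ⟨e₁, e₂, by rw [e₁, ← assoc, hr.u1_conv], by rw [e₂, ← assoc, lr.symm.u1_conv]⟩

lemma conv_δ2_assoc (hW : IsWeakHopf W) (f g l : H ⊗[k] H →ₗ[k] A) :
    WHA.conv k (δ2 W) (WHA.conv k (δ2 W) f g) l = WHA.conv k (δ2 W) f (WHA.conv k (δ2 W) g l) :=
  conv_assoc_s6 (C := H ⊗[k] H) (δC := δ2 W) (δ2_coassoc hW) f g l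

lemma IsRegPair2.u2_conv {σ σinv : H ⊗[k] H →ₗ[k] A} (hr : IsRegPair2 W φ σ σinv) :
    WHA.conv k (δ2 W) (u2 φ) σ = σ := by rw [← hr.1]; exact hr.2.2.1

lemma IsRegPair2.conv_u2 (hW : IsWeakHopf W) {σ σinv : H ⊗[k] H →ₗ[k] A}
    (hr : IsRegPair2 W φ σ σinv) : WHA.conv k (δ2 W) σ (u2 φ) = σ := by
  rw [← hr.2.1, ← conv_δ2_assoc hW]; exact hr.2.2.1

end Regular

section Equivalence

variable {A : Type} [Ring A] [Algebra k A] {W : HopfData k H} {φ ϕ χ : H ⊗[k] A →ₗ[k] A}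
  {σ σinv τ τinv ω : H ⊗[k] H →ₗ[k] A}

lemma IsCrossedSystem.equiv_refl (hW : IsWeakHopf W) (hσ : IsCrossedSystem W φ σ σinv) :
    CrossedEquiv W φ φ σ σ := by
  have hφ := hσ.1
  have hu := hφ.conv_u1_u1
  have hr : IsRegPair W φ (u1 φ) (u1 φ) := ⟨hu, hu, by rw [hu, hu], by rw [hu, hu]⟩
  refine ⟨rfl, u1 φ, u1 φ, hr, hr, hφ.u1_one, ?_, ?_⟩
  · refine fisEq_iff.2 fun b => ?_
    rw [hφ.conv_u1_flip, hφ.conv_flip_u1]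
  · refine (sigmasEq_iff hW).2 ?_
    rw [hφ.conv_extendLeft_u1_lTensor hW, hφ.lTensor_u1, ← u2, hσ.2.1.conv_u2 hW, hσ.2.1.u2_conv]

lemma CrossedEquiv.symm (hW : IsWeakHopf W) (hτ : IsCrossedSystem W ϕ τ τinv)
    (he : CrossedEquiv W φ ϕ σ τ) : CrossedEquiv W ϕ φ τ σ := by
  obtain ⟨hu, h, hinv, hr, hr', h1, hF, hS⟩ := he
  have hϕ := hτ.1
  have assoc := conv_assoc_s6 (A := A) hW.coassoc
  have assoc₂ := conv_δ2_assoc (A := A) hW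
  refine ⟨hu.symm, hinv, h, hr'.symm, hr.symm, hr'.inv_one hW hϕ h1, ?_, ?_⟩
  · refine fisEq_iff.2 fun b => ?_
    rw [fisEq_iff.1 hF b, assoc, assoc, hr'.2.1, assoc, hϕ.conv_flip_u1, ← assoc, hr'.2.1,
      hϕ.conv_u1_flip]
  · refine (sigmasEq_iff hW).2 ?_
    have hact : conv k (δ2 W) (extendLeft W hinv) (φ ∘ₗ LinearMap.lTensor H hinv) =
        conv k (δ2 W) (ϕ ∘ₗ LinearMap.lTensor H hinv) (extendLeft W hinv) := by
      rw [hF.lTensor_eq hW, assoc₂, ← assoc₂, conv_extendLeft hW, hr'.2.1, ← assoc₂,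
        hϕ.conv_extendLeft_u1_lTensor hW]
    have hcancel (G : H ⊗[k] H →ₗ[k] A) : conv k (δ2 W) (extendLeft W hinv)
        (conv k (δ2 W) (extendLeft W h) (conv k (δ2 W) (ϕ ∘ₗ LinearMap.lTensor H h) G)) =
        conv k (δ2 W) (ϕ ∘ₗ LinearMap.lTensor H h) G := by
      rw [← assoc₂, ← assoc₂, conv_extendLeft hW, hr'.2.1, hϕ.conv_extendLeft_u1_lTensor hW]
    rw [hact, (sigmasEq_iff hW).1 hS]
    simp only [assoc₂, hcancel]
    rw [conv_comp_mul' hW, hr'.2.1, ← u2, hτ.2.1.conv_u2 hW, ← assoc₂, hϕ.conv_lTensor,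
      hr'.2.1, hϕ.lTensor_u1, hτ.2.1.u2_conv]

lemma CrossedEquiv.trans (hW : IsWeakHopf W) (hϕ : IsWeakModAlg W ϕ) (hχ : IsWeakModAlg W χ)
    (he : CrossedEquiv W φ ϕ σ τ) (he' : CrossedEquiv W ϕ χ τ ω) : CrossedEquiv W φ χ σ ω := by
  obtain ⟨hu, h, hinv, hr, hr', h1, hF, hS⟩ := he
  obtain ⟨lu, l, linv, lr, lr', l1, lF, lS⟩ := he'
  have assoc := conv_assoc_s6 (A := A) hW.coassoc
  have assoc₂ := conv_δ2_assoc (A := A) hW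
  have lrφ : IsRegPair W φ l linv := by rwa [IsRegPair, hu]
  have hrχ : IsRegPair W χ h hinv := by rwa [IsRegPair, ← lu]
  refine ⟨hu.trans lu, conv k W.δ h l, conv k W.δ linv hinv, hr.conv hW lrφ, hrχ.conv hW lr',
    ?_, ?_, ?_⟩
  · rw [conv_apply_one hW hϕ (hr'.conv_u1 hW) h1 lr.u1_conv, l1]
  · refine fisEq_iff.2 fun b => ?_
    rw [fisEq_iff.1 hF b, fisEq_iff.1 lF b]
    simp only [assoc]
  · refine (sigmasEq_iff hW).2 ?_
    have hcancel (G : H ⊗[k] H →ₗ[k] A) : conv k (δ2 W) (extendLeft W linv)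
        (conv k (δ2 W) (extendLeft W l) (conv k (δ2 W) (χ ∘ₗ LinearMap.lTensor H l) G)) =
        conv k (δ2 W) (χ ∘ₗ LinearMap.lTensor H l) G := by
      rw [← assoc₂, ← assoc₂, conv_extendLeft hW, lr'.2.1, hχ.conv_extendLeft_u1_lTensor hW]
    rw [(sigmasEq_iff hW).1 hS, (sigmasEq_iff hW).1 lS, lF.lTensor_eq hW h, ← conv_extendLeft hW,
      ← hχ.conv_lTensor, ← conv_comp_mul' hW]
    simp only [assoc₂, hcancel]

end Equivalence

/-- For a cocommutative weak Hopf algebra `H` and an algebra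
`A`, the relation `≈` on crossed systems for `H` over `A` is an equivalence
relation: reflexive, symmetric and transitive. -/
theorem statement6 {k H A : Type} [CommRing k] [Ring H] [Algebra k H]
    [Ring A] [Algebra k A]
    (W : HopfData k H) (hW : IsWeakHopf W) (hcc : Cocomm W) :
    (∀ (φ : H ⊗[k] A →ₗ[k] A) (σ σinv : H ⊗[k] H →ₗ[k] A),
      IsCrossedSystem W φ σ σinv → CrossedEquiv W φ φ σ σ) ∧
    (∀ (φ ϕ : H ⊗[k] A →ₗ[k] A) (σ σinv τ τinv : H ⊗[k] H →ₗ[k] A),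
      IsCrossedSystem W φ σ σinv → IsCrossedSystem W ϕ τ τinv →
      CrossedEquiv W φ ϕ σ τ → CrossedEquiv W ϕ φ τ σ) ∧
    (∀ (φ ϕ χ : H ⊗[k] A →ₗ[k] A) (σ σinv τ τinv ω ωinv : H ⊗[k] H →ₗ[k] A),
      IsCrossedSystem W φ σ σinv → IsCrossedSystem W ϕ τ τinv →
      IsCrossedSystem W χ ω ωinv →
      CrossedEquiv W φ ϕ σ τ → CrossedEquiv W ϕ χ τ ω →
      CrossedEquiv W φ χ σ ω) := by
  exact ⟨fun _ _ _ hσ => hσ.equiv_refl hW, fun _ _ _ _ _ _ _ hτ he => he.symm hW hτ,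
    fun _ _ _ _ _ _ _ _ _ _ hτ hω he he' => he.trans hW hτ.1 hω.1 he'⟩

end WHA

end
end
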